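/- arXiv:1805.10961 — 2 statements merged into one kernel-verified Lean document; each statement's English description precedes it below -/
import Mathlib

section
/- For $x \in E^{(q-1)} = \{x \in \mathbb{R}^q : \sum x_i = 0\}$, let $\Omega^m_i(x) = \{z \in E^{(q-1)} : z_i - x_i > \max_{j \neq i}(z_j - x_j)\}$ be the translated Voronoi cells (the model simplicial cluster centered at $x$). Then the map $\Psi: E^{(q-1)} \to \mathbb{R}^q$, $\Psi(x)_i = \gamma(\Omega^m_i(x))$ (where $\gamma$ is the standard Gaussian measure on $E^{(q-1)}$) is injective. -/
open MeasureTheory ProbabilityTheory Real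

noncomputable section

/-- The sum of coordinates, as a linear functional on `EuclideanSpace ℝ (Fin q)`. -/
def sumCoords (q : ℕ) : EuclideanSpace ℝ (Fin q) →ₗ[ℝ] ℝ where
  toFun x := ∑ i, x i
  map_add' x y := Finset.sum_add_distrib
  map_smul' c x := by
    show ∑ i, c * x i = c * ∑ i, x i
    exact (Finset.mul_sum _ _ _).symm

/-- The hyperplane `E^{(q-1)} = {x ∈ ℝ^q : ∑ᵢ xᵢ = 0}`. -/
def Esp (q : ℕ) : Submodule ℝ (EuclideanSpace ℝ (Fin q)) := LinearMap.ker (sumCoords q)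

/-- The standard Gaussian measure on `E^{(q-1)}`. -/
def gaussE (q : ℕ) : Measure (Esp q) :=
  volume.withDensity fun x =>
    ENNReal.ofReal ((2 * π) ^ (-((q : ℝ) - 1) / 2) * Real.exp (-‖x‖ ^ 2 / 2))

/-- The translated Voronoi cell `Ω^m_i(x) = {z ∈ E^{(q-1)} : zᵢ - xᵢ > max_{j ≠ i} (zⱼ - xⱼ)}`
of the model simplicial cluster centered at `x`. -/
def modelCell (q : ℕ) (x : Esp q) (i : Fin q) : Set (Esp q) :=
  {z : Esp q | ∀ j : Fin q, j ≠ i →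
    (z : EuclideanSpace ℝ (Fin q)) j - (x : EuclideanSpace ℝ (Fin q)) j
      < (z : EuclideanSpace ℝ (Fin q)) i - (x : EuclideanSpace ℝ (Fin q)) i}

theorem mem_Esp_iff {q : ℕ} {x : EuclideanSpace ℝ (Fin q)} : x ∈ Esp q ↔ ∑ i, x i = 0 :=
  LinearMap.mem_ker

theorem integrable_exp_neg_norm_sq_div_two (V : Type*) [NormedAddCommGroup V]
    [InnerProductSpace ℝ V] [FiniteDimensional ℝ V] [MeasurableSpace V] [BorelSpace V] :
    Integrable (fun v : V => Real.exp (-‖v‖ ^ 2 / 2)) := by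
  have h := (GaussianFourier.integrable_cexp_neg_mul_sq_norm_add (V := V) (b := 1 / 2)
    (by norm_num) 0 0).norm
  refine h.congr (Filter.Eventually.of_forall fun v => ?_)
  have hv : (-(1 / 2 : ℂ) * (‖v‖ : ℂ) ^ 2 + 0 * ((inner ℝ (0 : V) v : ℝ) : ℂ))
      = ((-‖v‖ ^ 2 / 2 : ℝ) : ℂ) := by
    push_cast
    ring
  simp only [hv, Complex.norm_exp, Complex.ofReal_re]

instance isFiniteMeasure_gaussE (q : ℕ) : IsFiniteMeasure (gaussE q) :=
  isFiniteMeasure_withDensity_ofReal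
    ((integrable_exp_neg_norm_sq_div_two (Esp q)).const_mul _).2

instance isOpenPosMeasure_gaussE (q : ℕ) : (gaussE q).IsOpenPosMeasure := by
  have hac : (volume : Measure (Esp q)) ≪ gaussE q := by
    refine withDensity_absolutelyContinuous' (by fun_prop) ?_
    refine Filter.Eventually.of_forall fun x => ?_
    have : 0 < (2 * π) ^ (-((q : ℝ) - 1) / 2) * Real.exp (-‖x‖ ^ 2 / 2) := by positivity
    exact (ENNReal.ofReal_pos.2 this).ne'
  exact hac.isOpenPosMeasure

theorem isOpen_modelCell (q : ℕ) (x : Esp q) (i : Fin q) : IsOpen (modelCell q x i) := by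
  simp only [modelCell, Set.ofPred_forall]
  refine isOpen_iInter_of_finite fun j => isOpen_iInter_of_finite fun _ => ?_
  exact isOpen_lt (by fun_prop) (by fun_prop)

theorem modelCell_subset_modelCell {q : ℕ} {x y : Esp q} {i : Fin q}
    (h : ∀ j, y.1 j - x.1 j ≤ y.1 i - x.1 i) : modelCell q y i ⊆ modelCell q x i := by
  intro z hz j hj
  linarith [hz j hj, h j]

/-- Every cell contains points arbitrarily close to its centre. -/
theorem exists_mem_modelCell_sub_lt {q : ℕ} (x : Esp q) (i : Fin q) {ε : ℝ} (hε : 0 < ε) :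
    ∃ z ∈ modelCell q x i, ∀ k, (z.1 i - x.1 i) - (z.1 k - x.1 k) < ε := by
  have hq : (0 : ℝ) < q := by exact_mod_cast i.pos
  set a : ℝ := ε / 2 with ha
  let w : EuclideanSpace ℝ (Fin q) := WithLp.toLp 2 fun j => (if j = i then a else 0) - a / q
  have hw : w ∈ Esp q := by
    rw [mem_Esp_iff]
    simp [w, Finset.sum_sub_distrib, mul_div_cancel₀ _ hq.ne']
  refine ⟨x + ⟨w, hw⟩, fun j hj => ?_, fun k => ?_⟩
  · simp only [Submodule.coe_add, PiLp.add_apply, w, if_neg hj, if_true]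
    linarith
  · simp only [Submodule.coe_add, PiLp.add_apply, w, if_true]
    split_ifs <;> linarith

/-- If `i` is a largest coordinate of `y - x` and `k` is not, then the `i`-th cell centred at `y`
has strictly smaller Gaussian measure than the one centred at `x`. -/
theorem gaussE_modelCell_lt {q : ℕ} {x y : Esp q} {i k : Fin q}
    (h : ∀ j, y.1 j - x.1 j ≤ y.1 i - x.1 i) (hk : y.1 k - x.1 k < y.1 i - x.1 i) :
    gaussE q (modelCell q y i) < gaussE q (modelCell q x i) := by
  let U : Set (Esp q) := modelCell q x i ∩ {z | z.1 i - y.1 i < z.1 k - y.1 k}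
  have hU : IsOpen U :=
    (isOpen_modelCell q x i).inter (isOpen_lt (by fun_prop) (by fun_prop))
  have hne : U.Nonempty := by
    obtain ⟨z, hz, hzε⟩ := exists_mem_modelCell_sub_lt x i (sub_pos.2 hk)
    exact ⟨z, hz, by simp only [Set.mem_ofPred_eq]; linarith [hzε k]⟩
  have hki : k ≠ i := by
    rintro rfl
    exact hk.false
  have hdisj : Disjoint (modelCell q y i) U :=
    Set.disjoint_left.2 fun z hzy hzU => lt_asymm (hzy k hki) hzU.2
  calc gaussE q (modelCell q y i)
      < gaussE q (modelCell q y i) + gaussE q U :=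
        ENNReal.lt_add_right (measure_ne_top _ _) (hU.measure_pos _ hne).ne'
    _ = gaussE q (modelCell q y i ∪ U) := (measure_union hdisj hU.measurableSet).symm
    _ ≤ gaussE q (modelCell q x i) :=
        measure_mono (Set.union_subset (modelCell_subset_modelCell h) Set.inter_subset_left)

/-- A nonzero vector of `E^{(q-1)}` is not constant. -/
theorem eq_zero_of_forall_coord_eq {q : ℕ} (d : Esp q) (i : Fin q) (h : ∀ k, d.1 k = d.1 i) :
    d = 0 := by
  have hq : (q : ℝ) ≠ 0 := by exact_mod_cast i.pos.ne'
  have hs : (q : ℝ) * d.1 i = 0 := by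
    simpa [h] using mem_Esp_iff.1 d.2
  ext k
  simpa [h k] using (mul_eq_zero.1 hs).resolve_left hq

/-- The map `Ψ : E^{(q-1)} → ℝ^q`, `Ψ(x)ᵢ = γ(Ω^m_i(x))`, assigning to a center `x` the vector of
Gaussian measures of the cells of the model simplicial cluster centered at `x`, is injective. -/
theorem stmt5 (q : ℕ) :
    Function.Injective (fun x : Esp q => fun i : Fin q => gaussE q (modelCell q x i)) := by
  intro x y hxy
  by_contra hne
  have : Nonempty (Fin q) := by
    by_contra hempty
    rw [not_nonempty_iff] at hempty
    exact hne (Subtype.ext (Subsingleton.elim _ _))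
  obtain ⟨i, hi⟩ := Finite.exists_max fun j => y.1 j - x.1 j
  obtain ⟨k, hk⟩ : ∃ k, y.1 k - x.1 k < y.1 i - x.1 i := by
    by_contra! hall
    exact hne (sub_eq_zero.1 (eq_zero_of_forall_coord_eq (y - x) i fun k =>
      le_antisymm (hi k) (hall k))).symm
  exact (gaussE_modelCell_lt hi hk).ne (congrFun hxy i).symm

end
end

section
/- Let $B: E^{(q-1)} \to \mathbb{R}^n$ be a linear map such that $|B(e_i - e_j)| = 1$ for all $1 \le i < j \le q$. Then $B^T B = \frac{1}{2}\mathrm{Id}$ on $E^{(q-1)}$; that is, $\sqrt 2\, B$ is an isometry from $E^{(q-1)}$ onto its image. -/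
open scoped RealInnerProductSpace

noncomputable section

lemma stdDiff_mem (q : ℕ) (i j : Fin q) :
    EuclideanSpace.single i (1 : ℝ) - EuclideanSpace.single j (1 : ℝ) ∈ Esp q := by
  show sumCoords q _ = 0
  rw [map_sub]
  show (∑ k, EuclideanSpace.single i (1 : ℝ) k) - (∑ k, EuclideanSpace.single j (1 : ℝ) k) = 0
  simp [EuclideanSpace.single_apply]

/-- `e_i - e_j` as an element of `E^{(q-1)}`. -/
def stdDiffE (q : ℕ) (i j : Fin q) : Esp q :=
  ⟨EuclideanSpace.single i (1 : ℝ) - EuclideanSpace.single j (1 : ℝ), stdDiff_mem q i j⟩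

lemma eq_sum_smul_stdDiffE {q : ℕ} (k : Fin q) (x : Esp q) :
    x = ∑ i, (x : EuclideanSpace ℝ (Fin q)) i • stdDiffE q i k := by
  have hx : ∑ i, (x : EuclideanSpace ℝ (Fin q)) i = 0 := x.2
  ext m
  simp [stdDiffE, mul_sub, Finset.sum_sub_distrib, hx, Pi.single_apply]

lemma norm_map_stdDiffE_mul_self {q : ℕ} {F : Type*} [NormedAddCommGroup F] [Module ℝ F]
    (B : Esp q →ₗ[ℝ] F) (hB : ∀ i j : Fin q, i < j → ‖B (stdDiffE q i j)‖ = 1) (i j : Fin q) :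
    ‖B (stdDiffE q i j)‖ * ‖B (stdDiffE q i j)‖ = 1 - if i = j then 1 else 0 := by
  have hneg : stdDiffE q i j = -stdDiffE q j i := by
    ext1
    simp [stdDiffE]
  rcases lt_trichotomy i j with h | rfl | h
  · simp [hB i j h, h.ne]
  · have hzero : stdDiffE q i i = 0 := by
      ext1
      simp [stdDiffE]
    simp [hzero]
  · rw [hneg, map_neg, norm_neg, hB j i h]
    simp [ne_of_gt h]

/-- If `B : E^{(q-1)} → ℝ^n` is linear with `|B(eᵢ - eⱼ)| = 1` for all `i < j`, then
`BᵀB = ½ Id` on `E^{(q-1)}`; that is, `√2 B` is an isometry onto its image. -/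
theorem stmt13 {q n : ℕ} (B : Esp q →ₗ[ℝ] EuclideanSpace ℝ (Fin n))
    (hB : ∀ i j : Fin q, i < j → ‖B (stdDiffE q i j)‖ = 1) :
    ∀ x y : Esp q, ⟪B x, B y⟫ = (1 / 2) * ⟪x, y⟫ := by
  intro x y
  rcases isEmpty_or_nonempty (Fin q) with hq | ⟨⟨k⟩⟩
  · have hzero : ∀ z : Esp q, z = 0 := fun z => by
      ext i
      exact isEmptyElim i
    simp [hzero x, hzero y]
  have hx : ∑ i, (x : EuclideanSpace ℝ (Fin q)) i = 0 := x.2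
  have hy : ∑ i, (y : EuclideanSpace ℝ (Fin q)) i = 0 := y.2
  have hmap : ∀ z : Esp q,
      B z = ∑ i, (z : EuclideanSpace ℝ (Fin q)) i • B (stdDiffE q i k) := fun z => by
    conv_lhs => rw [eq_sum_smul_stdDiffE k z]
    simp
  have hdiff : ∀ i j, B (stdDiffE q i k) - B (stdDiffE q j k) = B (stdDiffE q i j) := by
    intro i j
    rw [← map_sub]
    congr 1
    ext1
    simp [stdDiffE]
  rw [hmap x, hmap y, inner_sum_smul_sum_smul_of_sum_eq_zero _ hx _ hy]
  simp only [hdiff, norm_map_stdDiffE_mul_self B hB, mul_sub, mul_one, Finset.sum_sub_distrib,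
    ← Finset.mul_sum, hy]
  simp [PiLp.inner_apply, mul_comm, div_eq_mul_inv]

end
end
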